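/- arXiv:1311.4208 — 6 statements merged into one kernel-verified Lean document; each statement's English description precedes it below -/
import Mathlib

section
/- Suppose in addition that the ranges of T and of S are closed subspaces of H₂ and H₃ respectively. Then there exists a constant C > 0 such that for every u ∈ dom S ∩ dom T*, one has ‖u‖² ≤ C·(‖Su‖² + ‖T*u‖² + ‖Hu‖²), where H is the orthogonal projection of H₂ onto ℋ = ker S ∩ ker T*. -/
/-- The kernel of a densely defined (partial) linear operator, as a submodule of the
ambient domain space. -/
def LinearPMap.kerSubmodule {𝕜 E F : Type*} [RCLike 𝕜]
    [NormedAddCommGroup E] [InnerProductSpace 𝕜 E]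
    [NormedAddCommGroup F] [InnerProductSpace 𝕜 F]
    (S : E →ₗ.[𝕜] F) : Submodule 𝕜 E :=
  (LinearMap.ker S.toFun).map S.domain.subtype

/-- The range of a (partial) linear operator, as a submodule of the codomain. -/
def LinearPMap.rangeSubmodule {𝕜 E F : Type*} [RCLike 𝕜]
    [NormedAddCommGroup E] [InnerProductSpace 𝕜 E]
    [NormedAddCommGroup F] [InnerProductSpace 𝕜 F]
    (T : E →ₗ.[𝕜] F) : Submodule 𝕜 F :=
  LinearMap.range T.toFun

theorem aux_bounded_preimage {E F : Type*}
    [NormedAddCommGroup E] [InnerProductSpace ℂ E] [CompleteSpace E]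
    [NormedAddCommGroup F] [InnerProductSpace ℂ F] [CompleteSpace F]
    (P : E →ₗ.[ℂ] F) (hP : P.IsClosed) (hr : IsClosed (P.rangeSubmodule : Set F)) :
    ∃ C > (0 : ℝ), ∀ y ∈ P.rangeSubmodule, ∃ x : P.domain, P x = y ∧ ‖(x : E)‖ ≤ C * ‖y‖ := by
  have : CompleteSpace P.graph := IsClosed.completeSpace_coe (hs := hP)
  have : CompleteSpace P.rangeSubmodule := IsClosed.completeSpace_coe (hs := hr)
  have hmem : ∀ g : P.graph, ((ContinuousLinearMap.snd ℂ E F).comp P.graph.subtypeL) g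
      ∈ P.rangeSubmodule := by
    rintro ⟨g, hg⟩
    obtain ⟨x, hx1, hx2⟩ := (LinearPMap.mem_graph_iff P).1 hg
    exact ⟨x, hx2⟩
  let f : P.graph →L[ℂ] P.rangeSubmodule :=
    ((ContinuousLinearMap.snd ℂ E F).comp P.graph.subtypeL).codRestrict P.rangeSubmodule hmem
  have hf : Function.Surjective f := by
    rintro ⟨y, x, hx⟩
    refine ⟨⟨(x, P x), P.mem_graph x⟩, ?_⟩
    exact Subtype.ext hx
  obtain ⟨C, hC, h⟩ := f.exists_preimage_norm_le hf
  refine ⟨C, hC, fun y hy => ?_⟩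
  obtain ⟨⟨g, hg⟩, hg1, hg2⟩ := h ⟨y, hy⟩
  obtain ⟨x, hx1, hx2⟩ := (LinearPMap.mem_graph_iff P).1 hg
  refine ⟨x, ?_, ?_⟩
  · rw [hx2]; exact congrArg Subtype.val hg1
  · rw [hx1]; exact (norm_fst_le g).trans hg2

theorem aux_arith {U V X A h s t C₁ C₂ : ℝ} (hU : 0 ≤ U) (hV : 0 ≤ V) (ht : 0 ≤ t) (hh : 0 ≤ h)
    (hn : V ^ 2 ≤ V * X + t * A) (hX : X ≤ C₁ * s) (hA : A ≤ C₂ * (V + C₁ * s))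
    (hUn : U ≤ h + V) :
    U ^ 2 ≤ (2 + 6 * C₁ ^ 2 + 6 * C₂ ^ 2) * (s ^ 2 + t ^ 2 + h ^ 2) := by
  have h1 : V ^ 2 ≤ V * (C₁ * s) + (C₂ * t) * (V + C₁ * s) := by
    have := mul_le_mul_of_nonneg_left hX hV
    have := mul_le_mul_of_nonneg_left hA ht
    linarith
  have h2 : V ^ 2 ≤ 3 * (C₁ * s) ^ 2 + 3 * (C₂ * t) ^ 2 := by
    nlinarith [sq_nonneg (V / 2 - C₁ * s), sq_nonneg (V / 2 - C₂ * t),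
      sq_nonneg (C₁ * s - C₂ * t)]
  have h3 : U ^ 2 ≤ 2 * h ^ 2 + 2 * V ^ 2 := by
    have : U ^ 2 ≤ (h + V) ^ 2 := pow_le_pow_left₀ hU hUn 2
    nlinarith [sq_nonneg (h - V)]
  have h4 : 0 ≤ C₁ ^ 2 * (t ^ 2 + h ^ 2) := by positivity
  have h5 : 0 ≤ C₂ ^ 2 * (s ^ 2 + h ^ 2) := by positivity
  nlinarith [sq_nonneg s, sq_nonneg t]

theorem aux_mem_ker {E F : Type*}
    [NormedAddCommGroup E] [InnerProductSpace ℂ E]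
    [NormedAddCommGroup F] [InnerProductSpace ℂ F]
    (P : E →ₗ.[ℂ] F) (x : E) : x ∈ P.kerSubmodule ↔ ∃ h : x ∈ P.domain, P ⟨x, h⟩ = 0 := by
  constructor
  · rintro ⟨y, hy, rfl⟩
    exact ⟨y.2, hy⟩
  · rintro ⟨h, h0⟩
    exact ⟨⟨x, h⟩, h0, rfl⟩

/-- If `T : H₁ → H₂` and `S : H₂ → H₃` are densely defined closed operators with
`range T ⊆ ker S` and both ranges closed, then the basic estimate
`‖u‖² ≤ C (‖Su‖² + ‖T*u‖² + ‖Hu‖²)` holds on `dom S ∩ dom T*`, where `H` is the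
orthogonal projection onto the harmonic space `ℋ = ker S ∩ ker T*`. -/
theorem basic_estimate_of_closed_range
    {H₁ H₂ H₃ : Type*}
    [NormedAddCommGroup H₁] [InnerProductSpace ℂ H₁] [CompleteSpace H₁]
    [NormedAddCommGroup H₂] [InnerProductSpace ℂ H₂] [CompleteSpace H₂]
    [NormedAddCommGroup H₃] [InnerProductSpace ℂ H₃] [CompleteSpace H₃]
    (T : H₁ →ₗ.[ℂ] H₂) (S : H₂ →ₗ.[ℂ] H₃)
    (hTdense : Dense (T.domain : Set H₁)) (hSdense : Dense (S.domain : Set H₂))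
    (hTclosed : T.IsClosed) (hSclosed : S.IsClosed)
    (hTS : T.rangeSubmodule ≤ S.kerSubmodule)
    (hTrange : IsClosed (T.rangeSubmodule : Set H₂))
    (hSrange : IsClosed (S.rangeSubmodule : Set H₃))
    -- `Hproj` is the orthogonal projection of `H₂` onto `ℋ = ker S ∩ ker T*`:
    (Hproj : H₂ → H₂)
    (hHmem : ∀ u, Hproj u ∈ S.kerSubmodule ⊓ T.adjoint.kerSubmodule)
    (hHorth : ∀ u, u - Hproj u ∈ (S.kerSubmodule ⊓ T.adjoint.kerSubmodule)ᗮ) :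
    ∃ C > (0 : ℝ), ∀ u (hu : u ∈ S.domain) (hu' : u ∈ T.adjoint.domain),
      ‖u‖ ^ 2 ≤ C * (‖S ⟨u, hu⟩‖ ^ 2 + ‖T.adjoint ⟨u, hu'⟩‖ ^ 2 + ‖Hproj u‖ ^ 2) := by
  obtain ⟨C₁, hC₁, hS⟩ := aux_bounded_preimage S hSclosed hSrange
  obtain ⟨C₂, hC₂, hT⟩ := aux_bounded_preimage T hTclosed hTrange
  have : CompleteSpace T.rangeSubmodule := IsClosed.completeSpace_coe (hs := hTrange)
  refine ⟨2 + 6 * C₁ ^ 2 + 6 * C₂ ^ 2, by positivity, fun u hu hu' => ?_⟩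
  obtain ⟨x, hx, hxn⟩ := hS (S ⟨u, hu⟩) ⟨⟨u, hu⟩, rfl⟩
  obtain ⟨hhS, hhS0⟩ := (aux_mem_ker S _).1 (hHmem u).1
  obtain ⟨hhT, hhT0⟩ := (aux_mem_ker T.adjoint _).1 (hHmem u).2
  set v := u - Hproj u with hv
  have hvT : v ∈ T.adjoint.domain := sub_mem hu' hhT
  have hTv : T.adjoint ⟨v, hvT⟩ = T.adjoint ⟨u, hu'⟩ := by
    have := T.adjoint.map_sub ⟨u, hu'⟩ ⟨_, hhT⟩
    rw [hhT0, sub_zero] at this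
    exact this
  have hw : v - x ∈ S.kerSubmodule := by
    refine (aux_mem_ker S _).2 ⟨sub_mem (sub_mem hu hhS) x.2, ?_⟩
    have h1 := S.map_sub ⟨u, hu⟩ ⟨_, hhS⟩
    have h2 := S.map_sub (⟨u, hu⟩ - ⟨_, hhS⟩) x
    rw [h1, hhS0, hx, sub_zero, sub_self] at h2
    exact h2
  set p := T.rangeSubmodule.starProjection (v - x) with hp
  have hpm : p ∈ T.rangeSubmodule := Submodule.starProjection_apply_mem _ _
  have hpn : ‖p‖ ≤ ‖v - x‖ := Submodule.norm_starProjection_apply_le _ _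
  have hb : v - x - p ∈ T.rangeSubmoduleᗮ := Submodule.sub_starProjection_mem_orthogonal _
  have hbT : ∀ z : T.domain, inner ℂ (0 : H₁) (z : H₁) = inner ℂ (v - x - p) (T z) := by
    intro z
    rw [inner_zero_left]
    exact (Submodule.inner_left_of_mem_orthogonal (K := T.rangeSubmodule) ⟨z, rfl⟩ hb).symm
  have hbm : v - x - p ∈ S.kerSubmodule ⊓ T.adjoint.kerSubmodule := by
    refine ⟨sub_mem hw (hTS hpm), (aux_mem_ker _ _).2 ⟨?_, ?_⟩⟩
    · exact LinearPMap.mem_adjoint_domain_of_exists _ ⟨0, hbT⟩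
    · exact LinearPMap.adjoint_apply_eq hTdense _ hbT
  have hvb : inner ℂ v (v - x - p) = 0 :=
    Submodule.inner_left_of_mem_orthogonal hbm (hHorth u)
  obtain ⟨a, ha, han⟩ := hT p hpm
  have hvp : inner ℂ v p = inner ℂ (T.adjoint ⟨u, hu'⟩) (a : H₁) := by
    rw [← ha, ← hTv]
    exact (LinearPMap.adjoint_isFormalAdjoint hTdense ⟨v, hvT⟩ a).symm
  have hvv : inner ℂ v v = inner ℂ v (x : H₂) + inner ℂ (T.adjoint ⟨u, hu'⟩) (a : H₁) := by
    rw [inner_sub_right v (v - (x : H₂)) p, inner_sub_right v v (x : H₂)] at hvb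
    rw [← hvp]
    linear_combination hvb
  have hn : ‖v‖ ^ 2 ≤ ‖v‖ * ‖(x : H₂)‖ + ‖T.adjoint ⟨u, hu'⟩‖ * ‖(a : H₁)‖ := by
    have h1 : ‖inner ℂ v v‖ = ‖v‖ ^ 2 := by
      rw [inner_self_eq_norm_sq_to_K]; simp
    rw [← h1, hvv]
    exact (norm_add_le _ _).trans (add_le_add (norm_inner_le_norm _ _) (norm_inner_le_norm _ _))
  have hvx : ‖v - x‖ ≤ ‖v‖ + ‖(x : H₂)‖ := norm_sub_le _ _
  have hun : ‖u‖ ≤ ‖Hproj u‖ + ‖v‖ := by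
    have : u = Hproj u + v := by rw [hv]; abel
    calc ‖u‖ = ‖Hproj u + v‖ := by rw [← this]
      _ ≤ _ := norm_add_le _ _
  have ha' : ‖(a : H₁)‖ ≤ C₂ * (‖v‖ + C₁ * ‖S ⟨u, hu⟩‖) :=
    han.trans (mul_le_mul_of_nonneg_left (by linarith) hC₂.le)
  exact aux_arith (norm_nonneg _) (norm_nonneg _) (norm_nonneg _) (norm_nonneg _)
    hn hxn ha' hun
end

section
/- Suppose there exists a constant C > 0 such that for every u ∈ dom S ∩ dom T*, one has ‖u‖² ≤ C·(‖Su‖² + ‖T*u‖² + ‖Hu‖²), where H is the orthogonal projection of H₂ onto ℋ = ker S ∩ ker T*. Then the range of T and the range of S are closed subspaces of H₂ and H₃ respectively. -/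
section Helpers

theorem mem_kerSubmodule_iff_graph {E F : Type*}
    [NormedAddCommGroup E] [InnerProductSpace ℂ E]
    [NormedAddCommGroup F] [InnerProductSpace ℂ F] (S : E →ₗ.[ℂ] F) (x : E) :
    x ∈ S.kerSubmodule ↔ (x, (0 : F)) ∈ S.graph := by
  unfold LinearPMap.kerSubmodule
  rw [LinearPMap.mem_graph_iff]
  constructor
  · rintro ⟨y, hy, rfl⟩
    exact ⟨y, rfl, hy⟩
  · rintro ⟨y, h1, h2⟩
    exact ⟨y, h2, h1⟩

theorem mem_rangeSubmodule_iff_graph {E F : Type*}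
    [NormedAddCommGroup E] [InnerProductSpace ℂ E]
    [NormedAddCommGroup F] [InnerProductSpace ℂ F] (S : E →ₗ.[ℂ] F) (y : F) :
    y ∈ S.rangeSubmodule ↔ ∃ x, (x, y) ∈ S.graph := by
  unfold LinearPMap.rangeSubmodule
  constructor
  · rintro ⟨x, rfl⟩
    exact ⟨x, LinearPMap.mem_graph S x⟩
  · rintro ⟨x, hx⟩
    rw [LinearPMap.mem_graph_iff] at hx
    obtain ⟨z, h1, h2⟩ := hx
    exact ⟨z, h2⟩

theorem isClosed_kerSubmodule {E F : Type*}
    [NormedAddCommGroup E] [InnerProductSpace ℂ E]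
    [NormedAddCommGroup F] [InnerProductSpace ℂ F]
    (S : E →ₗ.[ℂ] F) (hS : S.IsClosed) : IsClosed (S.kerSubmodule : Set E) := by
  have : (S.kerSubmodule : Set E) = (fun x : E => (x, (0 : F))) ⁻¹' (S.graph : Set (E × F)) := by
    ext x
    exact mem_kerSubmodule_iff_graph S x
  rw [this]
  exact IsClosed.preimage (by fun_prop) hS

theorem isClosed_range_of_bound {E F : Type*}
    [NormedAddCommGroup E] [InnerProductSpace ℂ E] [CompleteSpace E]
    [NormedAddCommGroup F] [InnerProductSpace ℂ F]
    (S : E →ₗ.[ℂ] F) (hS : S.IsClosed) (K : ℝ) (hK : 0 < K)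
    (h : ∀ x y, (x, y) ∈ S.graph → x ∈ S.kerSubmoduleᗮ → ‖x‖ ≤ K * ‖y‖) :
    IsClosed (S.rangeSubmodule : Set F) := by
  have hker := isClosed_kerSubmodule S hS
  haveI : CompleteSpace S.kerSubmodule := hker.completeSpace_coe
  have key : ∀ y ∈ S.rangeSubmodule, ∃ x, (x, y) ∈ S.graph ∧ x ∈ S.kerSubmoduleᗮ := by
    intro y hy
    obtain ⟨x, hx⟩ := (mem_rangeSubmodule_iff_graph S y).1 hy
    refine ⟨x - S.kerSubmodule.starProjection x, ?_, ?_⟩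
    · have h0 := (mem_kerSubmodule_iff_graph S _).1
        (Submodule.starProjection_apply_mem S.kerSubmodule x)
      simpa using S.graph.sub_mem hx h0
    · exact Submodule.sub_starProjection_mem_orthogonal x
  apply IsSeqClosed.isClosed
  intro y z hy hyz
  choose x hx hx' using fun n => key (y n) (hy n)
  have hc : CauchySeq x := by
    have hyc := hyz.cauchySeq
    rw [Metric.cauchySeq_iff] at hyc ⊢
    intro ε hε
    obtain ⟨N, hN⟩ := hyc (ε / K) (by positivity)
    refine ⟨N, fun m hm n hn => ?_⟩
    have h1 := hN m hm n hn
    have h2 := h (x m - x n) (y m - y n) (by simpa using S.graph.sub_mem (hx m) (hx n))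
      (Submodule.sub_mem _ (hx' m) (hx' n))
    rw [dist_eq_norm] at h1 ⊢
    rw [lt_div_iff₀ hK] at h1
    linarith
  obtain ⟨a, ha⟩ := cauchySeq_tendsto_of_complete hc
  have : (a, z) ∈ S.graph := by
    have hS' : IsClosed (S.graph : Set (E × F)) := hS
    exact hS'.mem_of_tendsto (ha.prodMk_nhds hyz) (Filter.Eventually.of_forall hx)
  exact (mem_rangeSubmodule_iff_graph S z).2 ⟨a, this⟩

/-- `(ran T*)ᗮ ⊆ ker T` for closed densely defined `T`. -/
theorem orthogonal_range_adjoint_le {E F : Type*}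
    [NormedAddCommGroup E] [InnerProductSpace ℂ E] [CompleteSpace E]
    [NormedAddCommGroup F] [InnerProductSpace ℂ F] [CompleteSpace F]
    (T : E →ₗ.[ℂ] F) (hd : Dense (T.domain : Set E)) (hT : T.IsClosed) :
    T.adjoint.rangeSubmoduleᗮ ≤ T.kerSubmodule := by
  intro w hw
  rw [mem_kerSubmodule_iff_graph]
  let G : Submodule ℂ (WithLp 2 (E × F)) :=
    T.graph.comap (WithLp.linearEquiv 2 ℂ (E × F)).toLinearMap
  have hG : IsClosed (G : Set (WithLp 2 (E × F))) := by
    have hT' : IsClosed (T.graph : Set (E × F)) := hT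
    exact hT'.preimage (WithLp.prod_continuous_ofLp 2 E F)
  haveI : CompleteSpace G := hG.completeSpace_coe
  suffices hh : WithLp.toLp 2 (w, (0 : F)) ∈ G from hh
  rw [← Submodule.orthogonal_orthogonal G, Submodule.mem_orthogonal]
  intro p hp
  rw [Submodule.mem_orthogonal'] at hp
  have hab : ∀ x : T.domain, inner ℂ (-p.fst) (x : E) = inner ℂ p.snd (T x) := by
    intro x
    have h1 := hp (WithLp.toLp 2 ((x : E), T x)) (LinearPMap.mem_graph T x)
    simp only [WithLp.prod_inner_apply] at h1
    rw [inner_neg_left]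
    exact neg_eq_of_add_eq_zero_right h1
  have hb : p.snd ∈ T.adjoint.domain :=
    LinearPMap.mem_adjoint_domain_of_exists _ ⟨_, hab⟩
  have hTb := LinearPMap.adjoint_apply_eq hd ⟨p.snd, hb⟩ hab
  have h2 : -p.fst ∈ T.adjoint.rangeSubmodule := ⟨⟨p.snd, hb⟩, hTb⟩
  have h3 := (Submodule.mem_orthogonal _ _).1 hw _ h2
  rw [inner_neg_left, neg_eq_zero] at h3
  simp only [WithLp.prod_inner_apply, inner_zero_right, add_zero]
  exact h3

/-- Vectors orthogonal to `ran T` lie in `ker T*`. -/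
theorem orthogonal_range_le_ker_adjoint {E F : Type*}
    [NormedAddCommGroup E] [InnerProductSpace ℂ E] [CompleteSpace E]
    [NormedAddCommGroup F] [InnerProductSpace ℂ F]
    (T : E →ₗ.[ℂ] F) (hd : Dense (T.domain : Set E)) :
    T.rangeSubmoduleᗮ ≤ T.adjoint.kerSubmodule := by
  intro u hu
  have h0 : ∀ x : T.domain, inner ℂ (0 : E) (x : E) = inner ℂ u (T x) := by
    intro x
    rw [inner_zero_left]
    exact ((Submodule.mem_orthogonal' _ _).1 hu _ ⟨x, rfl⟩).symm
  have hm := LinearPMap.mem_adjoint_domain_of_exists (T := T) u ⟨0, h0⟩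
  exact ⟨⟨u, hm⟩, LinearPMap.adjoint_apply_eq hd ⟨u, hm⟩ h0, rfl⟩

end Helpers

/-- If the basic estimate `‖u‖² ≤ C (‖Su‖² + ‖T*u‖² + ‖Hu‖²)` holds on
`dom S ∩ dom T*`, where `H` is the orthogonal projection onto `ℋ = ker S ∩ ker T*`,
then the ranges of `T` and of `S` are closed. -/
theorem closed_range_of_basic_estimate
    {H₁ H₂ H₃ : Type*}
    [NormedAddCommGroup H₁] [InnerProductSpace ℂ H₁] [CompleteSpace H₁]
    [NormedAddCommGroup H₂] [InnerProductSpace ℂ H₂] [CompleteSpace H₂]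
    [NormedAddCommGroup H₃] [InnerProductSpace ℂ H₃] [CompleteSpace H₃]
    (T : H₁ →ₗ.[ℂ] H₂) (S : H₂ →ₗ.[ℂ] H₃)
    (hTdense : Dense (T.domain : Set H₁)) (hSdense : Dense (S.domain : Set H₂))
    (hTclosed : T.IsClosed) (hSclosed : S.IsClosed)
    (hTS : T.rangeSubmodule ≤ S.kerSubmodule)
    -- `Hproj` is the orthogonal projection of `H₂` onto `ℋ = ker S ∩ ker T*`:
    (Hproj : H₂ → H₂)
    (hHmem : ∀ u, Hproj u ∈ S.kerSubmodule ⊓ T.adjoint.kerSubmodule)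
    (hHorth : ∀ u, u - Hproj u ∈ (S.kerSubmodule ⊓ T.adjoint.kerSubmodule)ᗮ)
    (C : ℝ) (hC : 0 < C)
    (hbasic : ∀ u (hu : u ∈ S.domain) (hu' : u ∈ T.adjoint.domain),
      ‖u‖ ^ 2 ≤ C * (‖S ⟨u, hu⟩‖ ^ 2 + ‖T.adjoint ⟨u, hu'⟩‖ ^ 2 + ‖Hproj u‖ ^ 2)) :
    IsClosed (T.rangeSubmodule : Set H₂) ∧ IsClosed (S.rangeSubmodule : Set H₃) := by
  have hH0 : ∀ u ∈ (S.kerSubmodule ⊓ T.adjoint.kerSubmodule)ᗮ, Hproj u = 0 := by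
    intro u hu
    have h1 : Hproj u ∈ (S.kerSubmodule ⊓ T.adjoint.kerSubmodule)ᗮ := by
      simpa using Submodule.sub_mem _ hu (hHorth u)
    exact inner_self_eq_zero.1 ((Submodule.mem_orthogonal _ _).1 h1 _ (hHmem u))
  have hsq : ∀ a b : ℝ, 0 ≤ b → a ^ 2 ≤ C * b ^ 2 → a ≤ √C * b := by
    intro a b hb h
    refine abs_le_of_sq_le_sq' ?_ (by positivity) |>.2
    rw [mul_pow, Real.sq_sqrt hC.le]
    exact h
  have hker : IsClosed (S.kerSubmodule : Set H₂) := isClosed_kerSubmodule S hSclosed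
  constructor
  · apply isClosed_range_of_bound T hTclosed (√C) (Real.sqrt_pos.2 hC)
    intro x y hxy hx
    obtain ⟨x', rfl, rfl⟩ := (LinearPMap.mem_graph_iff T).1 hxy
    set N := T.rangeSubmodule.topologicalClosure with hN
    have hNcl : IsClosed (N : Set H₂) := T.rangeSubmodule.isClosed_topologicalClosure
    haveI : CompleteSpace N := hNcl.completeSpace_coe
    have hNS : N ≤ S.kerSubmodule := Submodule.topologicalClosure_minimal _ hTS hker
    have hNorth : Nᗮ ≤ T.adjoint.kerSubmodule :=
      (Submodule.orthogonal_le (Submodule.le_topologicalClosure _)).trans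
        (orthogonal_range_le_ker_adjoint T hTdense)
    -- `ran T` is orthogonal to `ker T*`
    have hNker : N ≤ (T.adjoint.kerSubmodule)ᗮ := by
      apply Submodule.topologicalClosure_minimal _ _ (Submodule.isClosed_orthogonal _)
      rintro _ ⟨z, rfl⟩
      rw [Submodule.mem_orthogonal]
      rintro _ ⟨u, hu, rfl⟩
      have h1 := LinearPMap.adjoint_isFormalAdjoint hTdense u z
      have h2 : T.adjoint u = 0 := hu
      rw [h2, inner_zero_left] at h1
      exact h1.symm
    -- estimate on `ran T*`
    have hran : ∀ r ∈ T.adjoint.rangeSubmodule,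
        ‖inner ℂ r (x' : H₁)‖ ≤ √C * ‖T x'‖ * ‖r‖ := by
      rintro _ ⟨u, rfl⟩
      have hd : (u : H₂) - N.starProjection u ∈ T.adjoint.kerSubmodule :=
        hNorth (Submodule.sub_starProjection_mem_orthogonal (u : H₂))
      have hgr := T.adjoint.graph.sub_mem (LinearPMap.mem_graph T.adjoint u)
        ((mem_kerSubmodule_iff_graph _ _).1 hd)
      simp only [Prod.mk_sub_mk, sub_sub_cancel, sub_zero] at hgr
      obtain ⟨p, hp1, hp2⟩ := (LinearPMap.mem_graph_iff T.adjoint).1 hgr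
      simp only at hp1 hp2
      have hpN : (p : H₂) ∈ N := hp1 ▸ Submodule.starProjection_apply_mem N (u : H₂)
      obtain ⟨s, hs, hsp⟩ := hNS hpN
      have hpS : (p : H₂) ∈ S.domain := hsp ▸ s.2
      have hSp : S ⟨p, hpS⟩ = 0 := by
        have : s = ⟨p, hpS⟩ := Subtype.ext hsp
        rw [← this]
        exact hs
      have hHp := hH0 p (Submodule.orthogonal_le inf_le_right (hNker hpN))
      have hb := hbasic p hpS p.2
      rw [hSp, hHp] at hb
      simp only [norm_zero, ne_eq, OfNat.ofNat_ne_zero, not_false_eq_true, zero_pow, zero_add,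
        add_zero, Subtype.coe_eta] at hb
      have hb' := hsq _ _ (norm_nonneg _) hb
      change ‖inner ℂ (T.adjoint u) (x' : H₁)‖ ≤ √C * ‖T x'‖ * ‖T.adjoint u‖
      rw [← hp2, LinearPMap.adjoint_isFormalAdjoint hTdense p x']
      calc _ ≤ ‖(p : H₂)‖ * ‖T x'‖ := norm_inner_le_norm _ _
        _ ≤ (√C * ‖T.adjoint p‖) * ‖T x'‖ := by gcongr
        _ = _ := by ring
    have hcl : (x' : H₁) ∈ T.adjoint.rangeSubmodule.topologicalClosure := by
      rw [← Submodule.orthogonal_orthogonal_eq_closure]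
      exact Submodule.orthogonal_le (orthogonal_range_adjoint_le T hTdense hTclosed) hx
    have hfin : ‖inner ℂ (x' : H₁) (x' : H₁)‖ ≤ √C * ‖T x'‖ * ‖(x' : H₁)‖ := by
      have hset : IsClosed {r : H₁ | ‖inner ℂ r (x' : H₁)‖ ≤ √C * ‖T x'‖ * ‖r‖} :=
        isClosed_le (by fun_prop) (by fun_prop)
      exact closure_minimal hran hset hcl
    rw [inner_self_eq_norm_sq_to_K] at hfin
    simp only [norm_pow, Complex.coe_algebraMap, Complex.norm_real, norm_norm] at hfin
    by_cases h0 : ‖(x' : H₁)‖ = 0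
    · simp only [h0]
      positivity
    · have hpos : 0 < ‖(x' : H₁)‖ := lt_of_le_of_ne (norm_nonneg _) (Ne.symm h0)
      rw [sq] at hfin
      exact le_of_mul_le_mul_right hfin hpos
  · apply isClosed_range_of_bound S hSclosed (√C) (Real.sqrt_pos.2 hC)
    intro x y hxy hx
    obtain ⟨x', rfl, rfl⟩ := (LinearPMap.mem_graph_iff S).1 hxy
    obtain ⟨t, ht, htx⟩ := orthogonal_range_le_ker_adjoint T hTdense
      (Submodule.orthogonal_le hTS hx)
    have hxT : (x' : H₂) ∈ T.adjoint.domain := htx ▸ t.2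
    have hTx : T.adjoint ⟨x', hxT⟩ = 0 := by
      have : t = ⟨x', hxT⟩ := Subtype.ext htx
      rw [← this]
      exact ht
    have hHx := hH0 x' (Submodule.orthogonal_le inf_le_left hx)
    have hb := hbasic x' x'.2 hxT
    rw [hTx, hHx] at hb
    simp only [norm_zero, ne_eq, OfNat.ofNat_ne_zero, not_false_eq_true, zero_pow,
      add_zero, Subtype.coe_eta] at hb
    exact hsq _ _ (norm_nonneg _) hb
end

section
/- Suppose the ranges of T and of S are closed. Let H₀ be a normed space, ι : H₂ → H₀ a bounded linear map, and c > 0 a constant such that ‖v‖ ≤ c·‖ι v‖ for every v ∈ ℋ = ker S ∩ ker T*. Then there exists a constant C > 0 such that for every u ∈ dom S ∩ dom T*, ‖Hu‖ ≤ C·(‖ι u‖ + ‖Su‖ + ‖T*u‖), where H is the orthogonal projection of H₂ onto ℋ. -/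
theorem LinearPMap.mem_kerSubmodule_aux {𝕜 E F : Type*} [RCLike 𝕜]
    [NormedAddCommGroup E] [InnerProductSpace 𝕜 E]
    [NormedAddCommGroup F] [InnerProductSpace 𝕜 F]
    (S : E →ₗ.[𝕜] F) (x : E) :
    x ∈ S.kerSubmodule ↔ ∃ h : x ∈ S.domain, S ⟨x, h⟩ = 0 := by
  unfold LinearPMap.kerSubmodule
  constructor
  · rintro ⟨y, hy, rfl⟩
    exact ⟨y.2, hy⟩
  · rintro ⟨h, hx⟩
    exact ⟨⟨x, h⟩, hx, rfl⟩

theorem pmap_preimage_aux {E F : Type*}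
    [NormedAddCommGroup E] [InnerProductSpace ℂ E] [CompleteSpace E]
    [NormedAddCommGroup F] [InnerProductSpace ℂ F] [CompleteSpace F]
    (f : E →ₗ.[ℂ] F) (hf : f.IsClosed) (hr : IsClosed (f.rangeSubmodule : Set F)) :
    ∃ K > (0 : ℝ), ∀ y : f.domain, ∃ x : f.domain, f x = f y ∧ ‖(x : E)‖ ≤ K * ‖f y‖ := by
  have hg : IsClosed (f.graph : Set (E × F)) := hf
  have : CompleteSpace f.graph := hg.completeSpace_coe
  have : CompleteSpace f.rangeSubmodule := hr.completeSpace_coe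
  have hmem : ∀ p : f.graph, (p : E × F).2 ∈ f.rangeSubmodule := by
    rintro ⟨p, hp⟩
    obtain ⟨y, hy1, hy2⟩ := (LinearPMap.mem_graph_iff f).1 hp
    exact ⟨y, hy2⟩
  let g : f.graph →L[ℂ] f.rangeSubmodule :=
    ((ContinuousLinearMap.snd ℂ E F).comp f.graph.subtypeL).codRestrict f.rangeSubmodule hmem
  have hsurj : Function.Surjective g := by
    rintro ⟨_, y, rfl⟩
    exact ⟨⟨(y, f y), f.mem_graph y⟩, rfl⟩
  obtain ⟨K, hK, h⟩ := g.exists_preimage_norm_le hsurj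
  refine ⟨K, hK, fun y => ?_⟩
  obtain ⟨⟨p, hp⟩, hp1, hp2⟩ := h ⟨f y, y, rfl⟩
  obtain ⟨x, hx1, hx2⟩ := (LinearPMap.mem_graph_iff f).1 hp
  have e : p.2 = f y := congrArg Subtype.val hp1
  refine ⟨x, hx2.trans e, ?_⟩
  rw [hx1]
  exact (norm_fst_le p).trans hp2

/-- If the ranges of `T` and `S` are closed and `‖v‖ ≤ c ‖ι v‖` on the harmonic space
`ℋ = ker S ∩ ker T*`, then `‖Hu‖ ≤ C (‖ι u‖ + ‖Su‖ + ‖T*u‖)` on `dom S ∩ dom T*`. -/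
theorem harmonic_projection_estimate
    {H₁ H₂ H₃ H₀ : Type*}
    [NormedAddCommGroup H₁] [InnerProductSpace ℂ H₁] [CompleteSpace H₁]
    [NormedAddCommGroup H₂] [InnerProductSpace ℂ H₂] [CompleteSpace H₂]
    [NormedAddCommGroup H₃] [InnerProductSpace ℂ H₃] [CompleteSpace H₃]
    [NormedAddCommGroup H₀] [NormedSpace ℂ H₀]
    (T : H₁ →ₗ.[ℂ] H₂) (S : H₂ →ₗ.[ℂ] H₃)
    (hTdense : Dense (T.domain : Set H₁)) (hSdense : Dense (S.domain : Set H₂))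
    (hTclosed : T.IsClosed) (hSclosed : S.IsClosed)
    (hTS : T.rangeSubmodule ≤ S.kerSubmodule)
    (hTrange : IsClosed (T.rangeSubmodule : Set H₂))
    (hSrange : IsClosed (S.rangeSubmodule : Set H₃))
    (ι : H₂ →L[ℂ] H₀) (c : ℝ) (hc : 0 < c)
    (hιest : ∀ v ∈ S.kerSubmodule ⊓ T.adjoint.kerSubmodule, ‖v‖ ≤ c * ‖ι v‖)
    -- `Hproj` is the orthogonal projection of `H₂` onto `ℋ = ker S ∩ ker T*`:
    (Hproj : H₂ → H₂)
    (hHmem : ∀ u, Hproj u ∈ S.kerSubmodule ⊓ T.adjoint.kerSubmodule)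
    (hHorth : ∀ u, u - Hproj u ∈ (S.kerSubmodule ⊓ T.adjoint.kerSubmodule)ᗮ) :
    ∃ C > (0 : ℝ), ∀ u (hu : u ∈ S.domain) (hu' : u ∈ T.adjoint.domain),
      ‖Hproj u‖ ≤ C * (‖ι u‖ + ‖S ⟨u, hu⟩‖ + ‖T.adjoint ⟨u, hu'⟩‖) := by
  obtain ⟨K, hK, hKS⟩ := pmap_preimage_aux S hSclosed hSrange
  obtain ⟨L, hL, hLT⟩ := pmap_preimage_aux T hTclosed hTrange
  have hadj := T.adjoint_isFormalAdjoint hTdense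
  have key : ∀ w (hw : w ∈ S.domain) (hw' : w ∈ T.adjoint.domain),
      w ∈ (S.kerSubmodule ⊓ T.adjoint.kerSubmodule)ᗮ →
      ‖w‖ ≤ 2 * (K * ‖S ⟨w, hw⟩‖ + L * ‖T.adjoint ⟨w, hw'⟩‖) := by
    intro w hw hw' hperp
    obtain ⟨x, hx1, hx2⟩ := hKS ⟨w, hw⟩
    have : CompleteSpace T.rangeSubmodule := hTrange.completeSpace_coe
    have hk : w - x ∈ S.kerSubmodule := by
      rw [LinearPMap.mem_kerSubmodule_aux]
      refine ⟨S.domain.sub_mem hw x.2, ?_⟩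
      have := S.map_sub ⟨w, hw⟩ x
      rw [hx1, sub_self] at this
      exact this
    obtain ⟨r, hr, h, hh, hrh⟩ :=
      Submodule.exists_add_mem_mem_orthogonal (K := T.rangeSubmodule) (w - (x : H₂))
    have hhS : h ∈ S.kerSubmodule := by
      have : h = (w - x) - r := by rw [hrh]; abel
      rw [this]
      exact Submodule.sub_mem _ hk (hTS hr)
    have hh0 : ∀ z : T.domain, inner ℂ h (T z) = 0 := fun z =>
      (Submodule.mem_orthogonal' _ _).1 hh _ ⟨z, rfl⟩
    have hhT : h ∈ T.adjoint.kerSubmodule := by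
      rw [LinearPMap.mem_kerSubmodule_aux]
      have hd : h ∈ T.adjoint.domain :=
        LinearPMap.mem_adjoint_domain_of_exists h ⟨0, fun z => by rw [hh0 z, inner_zero_left]⟩
      exact ⟨hd, LinearPMap.adjoint_apply_eq hTdense ⟨h, hd⟩
        (fun z => by rw [inner_zero_left]; exact (hh0 z).symm)⟩
    have hwh : inner ℂ w h = 0 := (Submodule.mem_orthogonal' _ _).1 hperp h ⟨hhS, hhT⟩
    obtain ⟨y₀, rfl⟩ := hr
    obtain ⟨y, hy1, hy2⟩ := hLT y₀
    have hrn : ‖T y₀‖ ≤ ‖w - (x : H₂)‖ := by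
      have h0 : inner ℂ (T y₀) h = 0 := (Submodule.mem_orthogonal _ _).1 hh _ ⟨y₀, rfl⟩
      have := norm_add_sq_eq_norm_sq_add_norm_sq_of_inner_eq_zero (T y₀) h h0
      have e : w - (x : H₂) = T y₀ + h := hrh
      rw [e]
      nlinarith [norm_nonneg h, norm_nonneg (T y₀ + h), norm_nonneg (T y₀)]
    have hwr : inner ℂ w (T y₀) = inner ℂ (T.adjoint ⟨w, hw'⟩) (y : H₁) := by
      rw [← hy1]
      exact (hadj ⟨w, hw'⟩ y).symm
    have hww : inner ℂ w w = inner ℂ w (x : H₂) + inner ℂ (T.adjoint ⟨w, hw'⟩) (y : H₁) := by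
      have e : w = x + (T y₀ + h) := by
        have e : w - (x : H₂) = T y₀ + h := hrh
        rw [← e]; abel
      have e' : inner ℂ w w = inner ℂ w ((x : H₂) + (T y₀ + h)) := congrArg (inner ℂ w) e
      rw [e', inner_add_right, inner_add_right, hwh, hwr, add_zero]
    have h1 : ‖w‖ * ‖w‖ ≤ ‖w‖ * ‖(x : H₂)‖ + ‖T.adjoint ⟨w, hw'⟩‖ * ‖(y : H₁)‖ := by
      have e : ‖inner ℂ w w‖ = ‖w‖ * ‖w‖ := by
        rw [inner_self_eq_norm_sq_to_K]; simp [sq]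
      rw [← e, hww]
      exact (norm_add_le _ _).trans (add_le_add (norm_inner_le_norm _ _) (norm_inner_le_norm _ _))
    have h2 : ‖(y : H₁)‖ ≤ L * (‖w‖ + K * ‖S ⟨w, hw⟩‖) :=
      hy2.trans (mul_le_mul_of_nonneg_left (hrn.trans ((norm_sub_le _ _).trans (by linarith))) hL.le)
    have hs : 0 ≤ K * ‖S ⟨w, hw⟩‖ := by positivity
    have ht : 0 ≤ L * ‖T.adjoint ⟨w, hw'⟩‖ := by positivity
    have h3 : ‖T.adjoint ⟨w, hw'⟩‖ * ‖(y : H₁)‖ ≤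
        (L * ‖T.adjoint ⟨w, hw'⟩‖) * (‖w‖ + K * ‖S ⟨w, hw⟩‖) :=
      (mul_le_mul_of_nonneg_left h2 (norm_nonneg _)).trans (le_of_eq (by ring))
    have h4 : ‖w‖ * ‖(x : H₂)‖ ≤ ‖w‖ * (K * ‖S ⟨w, hw⟩‖) :=
      mul_le_mul_of_nonneg_left hx2 (norm_nonneg _)
    have ha := norm_nonneg w
    generalize K * ‖S ⟨w, hw⟩‖ = s at *
    generalize L * ‖T.adjoint ⟨w, hw'⟩‖ = t at *
    generalize ‖w‖ = a at *
    by_contra! hcon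
    nlinarith [mul_nonneg hs ht, mul_nonneg hs hs, mul_nonneg ht ht, mul_nonneg ha hs,
      mul_nonneg ha ht]
  refine ⟨c + c * ‖ι‖ * (2 * (K + L)), by positivity, fun u hu hu' => ?_⟩
  obtain ⟨hm1, hm2⟩ := hHmem u
  obtain ⟨d1, z1⟩ := (LinearPMap.mem_kerSubmodule_aux _ _).1 hm1
  obtain ⟨d2, z2⟩ := (LinearPMap.mem_kerSubmodule_aux _ _).1 hm2
  have e1 : S ⟨u - Hproj u, S.domain.sub_mem hu d1⟩ = S ⟨u, hu⟩ := by
    have := S.map_sub ⟨u, hu⟩ ⟨_, d1⟩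
    rw [z1, sub_zero] at this
    exact this
  have e2 : T.adjoint ⟨u - Hproj u, T.adjoint.domain.sub_mem hu' d2⟩ = T.adjoint ⟨u, hu'⟩ := by
    have := T.adjoint.map_sub ⟨u, hu'⟩ ⟨_, d2⟩
    rw [z2, sub_zero] at this
    exact this
  have hw := key _ (S.domain.sub_mem hu d1) (T.adjoint.domain.sub_mem hu' d2) (hHorth u)
  rw [e1, e2] at hw
  have h1 := hιest _ (hHmem u)
  have h2 : ‖ι (Hproj u)‖ ≤ ‖ι u‖ + ‖ι‖ * ‖u - Hproj u‖ := by
    have e : ι (Hproj u) = ι u - ι (u - Hproj u) := by rw [← map_sub]; congr 1; abel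
    rw [e]
    exact (norm_sub_le _ _).trans (by linarith [ι.le_opNorm (u - Hproj u)])
  have hs := norm_nonneg (S ⟨u, hu⟩)
  have ht := norm_nonneg (T.adjoint ⟨u, hu'⟩)
  have hi := norm_nonneg (ι u)
  have hio := norm_nonneg ι
  generalize ‖S ⟨u, hu⟩‖ = s at *
  generalize ‖T.adjoint ⟨u, hu'⟩‖ = t at *
  generalize ‖ι u‖ = i at *
  have h3 : ‖u - Hproj u‖ ≤ 2 * (K + L) * (i + s + t) := by
    have : 0 ≤ K * i := by positivity
    have : 0 ≤ K * t := by positivity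
    have : 0 ≤ L * i := by positivity
    have : 0 ≤ L * s := by positivity
    nlinarith
  calc ‖Hproj u‖ ≤ c * (i + ‖ι‖ * (2 * (K + L) * (i + s + t))) := by
        refine h1.trans (mul_le_mul_of_nonneg_left (h2.trans ?_) hc.le)
        gcongr
    _ ≤ c * ((i + s + t) + ‖ι‖ * (2 * (K + L) * (i + s + t))) := by
        gcongr; linarith
    _ = _ := by ring
end

section
/- Suppose the ranges of T, T*, S, and S* are all closed, and let □ be the operator with domain dom □ = { u ∈ dom S ∩ dom T* : Su ∈ dom S* and T*u ∈ dom T } defined by □u = S*(Su) + T(T*u). Then there exists a unique bounded linear operator G : H₂ → H₂ such that Gv = 0 for every v ∈ ℋ, and for every u in the orthogonal complement ℋ^⊥ one has Gu ∈ dom □, Gu ∈ ℋ^⊥, and □(Gu) = u. -/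
open scoped InnerProductSpace

namespace GreenAux

section
variable {E F : Type*} [NormedAddCommGroup E] [InnerProductSpace ℂ E] [CompleteSpace E]
  [NormedAddCommGroup F] [InnerProductSpace ℂ F] [CompleteSpace F] (A : E →ₗ.[ℂ] F)

lemma mem_ker {x : E} : x ∈ A.kerSubmodule ↔ (x, (0 : F)) ∈ A.graph := by
  rw [LinearPMap.mem_graph_iff]
  constructor
  · rintro ⟨y, hy, rfl⟩
    exact ⟨y, rfl, hy⟩
  · rintro ⟨y, h1, h2⟩
    exact ⟨y, h2, h1⟩

lemma mem_range {y : F} : y ∈ A.rangeSubmodule ↔ ∃ x, (x, y) ∈ A.graph := by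
  constructor
  · rintro ⟨x, rfl⟩
    exact ⟨x, A.mem_graph x⟩
  · rintro ⟨x, h⟩
    obtain ⟨z, -, h2⟩ := (LinearPMap.mem_graph_iff A).1 h
    exact ⟨z, h2⟩

lemma of_graph {x : E} {y : F} (h : (x, y) ∈ A.graph) : ∃ hx : x ∈ A.domain, A ⟨x, hx⟩ = y := by
  obtain ⟨z, h1, h2⟩ := (LinearPMap.mem_graph_iff A).1 h
  simp only at h1 h2
  subst h1
  exact ⟨z.2, h2⟩

lemma mem_adj (hd : Dense (A.domain : Set E)) {y : F} {w : E} :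
    (y, w) ∈ A.adjoint.graph ↔ ∀ x z, (x, z) ∈ A.graph → ⟪w, x⟫_ℂ = ⟪y, z⟫_ℂ := by
  constructor
  · intro h x z hxz
    obtain ⟨h1, h2⟩ := of_graph _ h
    obtain ⟨h3, h4⟩ := of_graph _ hxz
    rw [← h2, ← h4]
    exact LinearPMap.adjoint_isFormalAdjoint hd ⟨y, h1⟩ ⟨x, h3⟩
  · intro h
    have h' : ∀ x : A.domain, ⟪w, x⟫_ℂ = ⟪y, A x⟫_ℂ := fun x => h _ _ (A.mem_graph x)
    have hy := LinearPMap.mem_adjoint_domain_of_exists y ⟨w, h'⟩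
    have := LinearPMap.adjoint_apply_eq hd ⟨y, hy⟩ h'
    rw [← this]
    exact A.adjoint.mem_graph ⟨y, hy⟩

lemma ker_adj (hd : Dense (A.domain : Set E)) : A.adjoint.kerSubmodule = A.rangeSubmoduleᗮ := by
  ext y
  rw [mem_ker, mem_adj A hd, Submodule.mem_orthogonal']
  constructor
  · intro h u hu
    obtain ⟨x, hx⟩ := (mem_range A).1 hu
    rw [← h x u hx, inner_zero_left]
  · intro h x z hxz
    rw [h z ((mem_range A).2 ⟨x, hxz⟩), inner_zero_left]

lemma ker_eq (hd : Dense (A.domain : Set E)) (hc : A.IsClosed) :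
    A.kerSubmodule = A.adjoint.rangeSubmoduleᗮ := by
  ext x
  rw [mem_ker, Submodule.mem_orthogonal]
  constructor
  · intro h u hu
    obtain ⟨y, hy⟩ := (mem_range _).1 hu
    rw [(mem_adj A hd).1 hy x 0 h, inner_zero_right]
  · intro h
    let e := WithLp.prodContinuousLinearEquiv 2 ℂ E F
    let K : Submodule ℂ (WithLp 2 (E × F)) := A.graph.comap e.toLinearEquiv.toLinearMap
    have hK : IsClosed (K : Set (WithLp 2 (E × F))) := hc.preimage e.continuous
    have : CompleteSpace K := hK.completeSpace_coe
    let v : WithLp 2 (E × F) := WithLp.toLp 2 (x, 0)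
    obtain ⟨g, hg, r, hr, hv⟩ := K.exists_add_mem_mem_orthogonal v
    have hg' : (g.fst, g.snd) ∈ A.graph := hg
    have hperp : ∀ a b, (a, b) ∈ A.graph → ⟪r.fst, a⟫_ℂ + ⟪r.snd, b⟫_ℂ = 0 := by
      intro a b hab
      have := (Submodule.mem_orthogonal' K r).1 hr (WithLp.toLp 2 (a, b)) hab
      simpa [WithLp.prod_inner_apply] using this
    have hadj : (r.snd, -r.fst) ∈ A.adjoint.graph := by
      rw [mem_adj A hd]
      intro a b hab
      rw [inner_neg_left]
      linear_combination -hperp a b hab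
    have h0 := h _ ((mem_range _).2 ⟨_, hadj⟩)
    have e1 : g.fst = x - r.fst := by
      have := congrArg WithLp.fst hv
      simp only [v, WithLp.add_fst] at this
      rw [eq_sub_iff_add_eq]; exact this.symm
    have e2 : g.snd = - r.snd := by
      have := congrArg WithLp.snd hv
      simp only [v, WithLp.add_snd] at this
      rw [eq_neg_iff_add_eq_zero]; exact this.symm
    have h1 := hperp _ _ hg'
    rw [e1, e2, inner_sub_right, inner_neg_right, inner_self_eq_norm_sq_to_K,
      inner_self_eq_norm_sq_to_K] at h1
    rw [inner_neg_left, neg_eq_zero] at h0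
    rw [h0] at h1
    have h2 : ‖r.fst‖ ^ 2 + ‖r.snd‖ ^ 2 = 0 := by
      have : ((‖r.fst‖ ^ 2 + ‖r.snd‖ ^ 2 : ℝ) : ℂ) = 0 := by
        push_cast
        simp only [Complex.coe_algebraMap] at h1
        linear_combination -h1
      exact_mod_cast this
    have r1 : r.fst = 0 := by
      rw [← norm_eq_zero]; nlinarith [sq_nonneg ‖r.fst‖, sq_nonneg ‖r.snd‖]
    have r2 : r.snd = 0 := by
      rw [← norm_eq_zero]; nlinarith [sq_nonneg ‖r.fst‖, sq_nonneg ‖r.snd‖]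
    rw [e1, e2, r1, r2] at hg'
    simpa using hg'

lemma pinv (hc : A.IsClosed) (hr : IsClosed (A.rangeSubmodule : Set F)) :
    ∃ P : F →L[ℂ] E, (∀ y ∈ A.rangeSubmodule, (P y, y) ∈ A.graph ∧ P y ∈ A.kerSubmoduleᗮ) ∧
      ∀ y ∈ A.rangeSubmoduleᗮ, P y = 0 := by
  have hk : IsClosed (A.kerSubmodule : Set E) := by
    have : (A.kerSubmodule : Set E) = (fun x : E => (x, (0 : F))) ⁻¹' (A.graph : Set (E × F)) := by
      ext x; exact mem_ker A
    rw [this]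
    exact IsClosed.preimage (by fun_prop) hc
  have : CompleteSpace A.kerSubmodule := hk.completeSpace_coe
  have : CompleteSpace A.rangeSubmodule := hr.completeSpace_coe
  let Γ : Submodule ℂ (E × F) := A.graph ⊓ (A.kerSubmoduleᗮ).comap (LinearMap.fst ℂ E F)
  have hΓ : IsClosed (Γ : Set (E × F)) :=
    IsClosed.inter hc ((Submodule.isClosed_orthogonal A.kerSubmodule).preimage continuous_fst)
  have : CompleteSpace Γ := hΓ.completeSpace_coe
  let f : Γ →L[ℂ] A.rangeSubmodule :=
    ((ContinuousLinearMap.snd ℂ E F).comp Γ.subtypeL).codRestrict A.rangeSubmodule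
      (fun g => (mem_range A).2 ⟨g.1.1, g.2.1⟩)
  have hf : ∀ g, (f g : F) = g.1.2 := fun g => rfl
  have hinj : LinearMap.ker f.toLinearMap = ⊥ := by
    rw [LinearMap.ker_eq_bot']
    intro g hg
    have h2 : g.1.2 = 0 := by rw [← hf]; exact congrArg Subtype.val hg
    have h1 : g.1.1 ∈ A.kerSubmodule := by
      rw [mem_ker, ← h2]; exact g.2.1
    have h3 : g.1.1 = 0 := by
      have := (Submodule.mem_orthogonal _ _).1 g.2.2 _ h1
      exact inner_self_eq_zero.1 this
    exact Subtype.ext (Prod.ext h3 h2)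
  have hsurj : LinearMap.range f.toLinearMap = ⊤ := by
    rw [LinearMap.range_eq_top]
    intro y
    obtain ⟨x, hx⟩ := (mem_range A).1 y.2
    obtain ⟨k, hk, p, hp, hv⟩ := A.kerSubmodule.exists_add_mem_mem_orthogonal x
    have : (p, (y : F)) ∈ A.graph := by
      have := A.graph.sub_mem hx ((mem_ker A).1 hk)
      simpa [hv] using this
    exact ⟨⟨(p, y), this, hp⟩, rfl⟩
  let e := ContinuousLinearEquiv.ofBijective f hinj hsurj
  refine ⟨((ContinuousLinearMap.fst ℂ E F).comp Γ.subtypeL).comp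
    ((e.symm : A.rangeSubmodule →L[ℂ] Γ).comp A.rangeSubmodule.orthogonalProjectionOnto), ?_, ?_⟩
  · intro y hy
    have h1 : A.rangeSubmodule.orthogonalProjectionOnto y = ⟨y, hy⟩ :=
      Submodule.orthogonalProjectionOnto_mem_subspace_eq_self (⟨y, hy⟩ : A.rangeSubmodule)
    have h2 : (e.symm ⟨y, hy⟩).1.2 = y := by
      rw [← hf]
      exact congrArg Subtype.val (e.apply_symm_apply ⟨y, hy⟩)
    simp only [ContinuousLinearMap.comp_apply, h1]
    refine ⟨?_, (e.symm ⟨y, hy⟩).2.2⟩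
    have := (e.symm ⟨y, hy⟩).2.1
    rw [← Prod.mk.eta (p := (e.symm ⟨y, hy⟩).1), h2] at this
    exact this
  · intro y hy
    have h1 : A.rangeSubmodule.orthogonalProjectionOnto y = 0 :=
      Submodule.orthogonalProjectionOnto_apply_of_mem_orthogonal hy
    simp [ContinuousLinearMap.comp_apply, h1]

end

end GreenAux

open GreenAux

/-- If the ranges of `T`, `T*`, `S`, `S*` are all closed, then there is a unique bounded
operator `G` on `H₂` vanishing on `ℋ = ker S ∩ ker T*` and inverting the complex
Laplacian `□u = S*(Su) + T(T*u)` on `ℋᗮ`. -/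
theorem green_operator_exists_unique
    {H₁ H₂ H₃ : Type*}
    [NormedAddCommGroup H₁] [InnerProductSpace ℂ H₁] [CompleteSpace H₁]
    [NormedAddCommGroup H₂] [InnerProductSpace ℂ H₂] [CompleteSpace H₂]
    [NormedAddCommGroup H₃] [InnerProductSpace ℂ H₃] [CompleteSpace H₃]
    (T : H₁ →ₗ.[ℂ] H₂) (S : H₂ →ₗ.[ℂ] H₃)
    (hTdense : Dense (T.domain : Set H₁)) (hSdense : Dense (S.domain : Set H₂))
    (hTclosed : T.IsClosed) (hSclosed : S.IsClosed)
    (hTS : T.rangeSubmodule ≤ S.kerSubmodule)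
    (hTrange : IsClosed (T.rangeSubmodule : Set H₂))
    (hTadjrange : IsClosed (T.adjoint.rangeSubmodule : Set H₁))
    (hSrange : IsClosed (S.rangeSubmodule : Set H₃))
    (hSadjrange : IsClosed (S.adjoint.rangeSubmodule : Set H₂)) :
    ∃! G : H₂ →L[ℂ] H₂,
      (∀ v ∈ S.kerSubmodule ⊓ T.adjoint.kerSubmodule, G v = 0) ∧
      ∀ u ∈ (S.kerSubmodule ⊓ T.adjoint.kerSubmodule)ᗮ,
        ∃ (h1 : G u ∈ S.domain) (h2 : G u ∈ T.adjoint.domain)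
          (h3 : S ⟨G u, h1⟩ ∈ S.adjoint.domain) (h4 : T.adjoint ⟨G u, h2⟩ ∈ T.domain),
          G u ∈ (S.kerSubmodule ⊓ T.adjoint.kerSubmodule)ᗮ ∧
          S.adjoint ⟨S ⟨G u, h1⟩, h3⟩ + T ⟨T.adjoint ⟨G u, h2⟩, h4⟩ = u := by
  have hTadjclosed : T.adjoint.IsClosed := LinearPMap.adjoint_isClosed hTdense
  have hSadjclosed : S.adjoint.IsClosed := LinearPMap.adjoint_isClosed hSdense
  have kS := ker_eq S hSdense hSclosed
  have kT := ker_eq T hTdense hTclosed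
  have kS' := ker_adj S hSdense
  have kT' := ker_adj T hTdense
  have : CompleteSpace T.rangeSubmodule := hTrange.completeSpace_coe
  have : CompleteSpace T.adjoint.rangeSubmodule := hTadjrange.completeSpace_coe
  have : CompleteSpace S.rangeSubmodule := hSrange.completeSpace_coe
  have : CompleteSpace S.adjoint.rangeSubmodule := hSadjrange.completeSpace_coe
  have kSo : S.kerSubmoduleᗮ = S.adjoint.rangeSubmodule := by
    rw [kS, Submodule.orthogonal_orthogonal]
  have kTo : T.kerSubmoduleᗮ = T.adjoint.rangeSubmodule := by
    rw [kT, Submodule.orthogonal_orthogonal]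
  have kSo' : S.adjoint.kerSubmoduleᗮ = S.rangeSubmodule := by
    rw [kS', Submodule.orthogonal_orthogonal]
  have kTo' : T.adjoint.kerSubmoduleᗮ = T.rangeSubmodule := by
    rw [kT', Submodule.orthogonal_orthogonal]
  -- the range of the adjoint of S lies in the kernel of the adjoint of T
  have hST : S.adjoint.rangeSubmodule ≤ T.adjoint.kerSubmodule := by
    rw [kT', ← kSo]
    exact Submodule.orthogonal_le hTS
  set N := S.kerSubmodule ⊓ T.adjoint.kerSubmodule with hN
  have hNclosed : IsClosed (N : Set H₂) := by
    rw [hN, kS, kT']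
    exact (Submodule.isClosed_orthogonal _).inter (Submodule.isClosed_orthogonal _)
  have : CompleteSpace N := hNclosed.completeSpace_coe
  have hdecomp : ∀ u ∈ Nᗮ, ∃ a ∈ S.adjoint.rangeSubmodule, ∃ b ∈ T.rangeSubmodule, u = a + b := by
    intro u hu
    obtain ⟨a, ha, c, hc, h1⟩ := S.adjoint.rangeSubmodule.exists_add_mem_mem_orthogonal u
    obtain ⟨b, hb, d, hd, h2⟩ := T.rangeSubmodule.exists_add_mem_mem_orthogonal c
    refine ⟨a, ha, b, hb, ?_⟩
    have hd1 : d ∈ N := by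
      refine ⟨?_, kT' ▸ hd⟩
      have : d = c - b := by rw [h2]; abel
      rw [this]
      exact Submodule.sub_mem _ (kS ▸ hc) (hTS hb)
    have hd2 : d ∈ Nᗮ := by
      have : d = u - a - b := by rw [h1, h2]; abel
      rw [this]
      refine Submodule.sub_mem _ (Submodule.sub_mem _ hu ?_) ?_
      · exact Submodule.orthogonal_le (inf_le_left : N ≤ S.kerSubmodule) (kSo ▸ ha)
      · exact Submodule.orthogonal_le (inf_le_right : N ≤ T.adjoint.kerSubmodule) (kTo' ▸ hb)
    have hd0 : d = 0 := inner_self_eq_zero.1 ((Submodule.mem_orthogonal _ _).1 hd2 _ hd1)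
    rw [h1, h2, hd0, add_zero]
  obtain ⟨P1, hP1, hP1'⟩ := pinv S hSclosed hSrange
  obtain ⟨P2, hP2, hP2'⟩ := pinv S.adjoint hSadjclosed hSadjrange
  obtain ⟨P3, hP3, hP3'⟩ := pinv T.adjoint hTadjclosed hTadjrange
  obtain ⟨P4, hP4, hP4'⟩ := pinv T hTclosed hTrange
  have hfor : ∀ u ∈ Nᗮ, ∃ s t a b, (P1 (P2 u) + P3 (P4 u), s) ∈ S.graph ∧
      (P1 (P2 u) + P3 (P4 u), t) ∈ T.adjoint.graph ∧ (s, a) ∈ S.adjoint.graph ∧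
      (t, b) ∈ T.graph ∧ a + b = u ∧ P1 (P2 u) + P3 (P4 u) ∈ Nᗮ := by
    intro u hu
    obtain ⟨a, ha, b, hb, rfl⟩ := hdecomp u hu
    have e1 : P2 (a + b) = P2 a := by
      rw [map_add, hP2' b (kS ▸ hTS hb), add_zero]
    have e2 : P4 (a + b) = P4 b := by
      rw [map_add, hP4' a (kT' ▸ hST ha), zero_add]
    rw [e1, e2]
    obtain ⟨p1, p2⟩ := hP2 a ha
    obtain ⟨p3, p4⟩ := hP1 (P2 a) (kSo' ▸ p2)
    obtain ⟨q1, q2⟩ := hP4 b hb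
    obtain ⟨q3, q4⟩ := hP3 (P4 b) (kTo ▸ q2)
    refine ⟨P2 a, P4 b, a, b, ?_, ?_, p1, q1, rfl, ?_⟩
    · have := S.graph.add_mem p3 ((mem_ker S).1 (hTS (kTo' ▸ q4)))
      simpa using this
    · have := T.adjoint.graph.add_mem ((mem_ker T.adjoint).1 (hST (kSo ▸ p4))) q3
      simpa using this
    · exact Submodule.add_mem _
        (Submodule.orthogonal_le (inf_le_left : N ≤ S.kerSubmodule) p4)
        (Submodule.orthogonal_le (inf_le_right : N ≤ T.adjoint.kerSubmodule) q4)
  refine ⟨P1.comp P2 + P3.comp P4, ⟨?_, ?_⟩, ?_⟩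
  · intro v hv
    have h1 := hP2' v (kS ▸ hv.1)
    have h2 := hP4' v (kT' ▸ hv.2)
    simp [h1, h2]
  · intro u hu
    obtain ⟨s, t, a, b, h1, h2, h3, h4, h5, h6⟩ := hfor u hu
    obtain ⟨g1, rfl⟩ := of_graph _ h1
    obtain ⟨g2, rfl⟩ := of_graph _ h2
    obtain ⟨g3, rfl⟩ := of_graph _ h3
    obtain ⟨g4, rfl⟩ := of_graph _ h4
    exact ⟨g1, g2, g3, g4, h6, h5⟩
  · rintro G' ⟨hG0, hG⟩
    ext u
    obtain ⟨n, hn, w, hw, rfl⟩ := N.exists_add_mem_mem_orthogonal u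
    have z1 := hP2' n (kS ▸ hn.1)
    have z2 := hP4' n (kT' ▸ hn.2)
    have goal' : G' w = P1 (P2 w) + P3 (P4 w) := by
      obtain ⟨s, t, a, b, h1, h2, h3, h4, h5, h6⟩ := hfor w hw
      obtain ⟨g1, g2, g3, g4, g5, g6⟩ := hG w hw
      set g := P1 (P2 w) + P3 (P4 w)
      have d1 := S.graph.sub_mem (S.mem_graph ⟨G' w, g1⟩) h1
      have d2 := T.adjoint.graph.sub_mem (T.adjoint.mem_graph ⟨G' w, g2⟩) h2
      have d3 := S.adjoint.graph.sub_mem (S.adjoint.mem_graph ⟨_, g3⟩) h3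
      have d4 := T.graph.sub_mem (T.mem_graph ⟨_, g4⟩) h4
      simp only [Prod.mk_sub_mk] at d1 d2 d3 d4
      have d5 := Submodule.sub_mem _ g5 h6
      have i1 := (mem_adj S hSdense).1 d3 _ _ d1
      have i2 := (mem_adj T hTdense).1 d2 _ _ d4
      have i3 := congrArg (starRingEnd ℂ) i2
      rw [inner_conj_symm, inner_conj_symm] at i3
      set s' := S ⟨G' w, g1⟩ - s
      set t' := T.adjoint ⟨G' w, g2⟩ - t
      have hsum : (S.adjoint ⟨S ⟨G' w, g1⟩, g3⟩ - a) +
          (T ⟨T.adjoint ⟨G' w, g2⟩, g4⟩ - b) = 0 := by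
        rw [← add_sub_add_comm, g6, h5, sub_self]
      have i4 : ⟪s', s'⟫_ℂ + ⟪t', t'⟫_ℂ = 0 := by
        rw [← i1, i3, ← inner_add_left, hsum, inner_zero_left]
      rw [inner_self_eq_norm_sq_to_K, inner_self_eq_norm_sq_to_K] at i4
      have i5 : ‖s'‖ ^ 2 + ‖t'‖ ^ 2 = 0 := by
        simp only [Complex.coe_algebraMap] at i4
        exact_mod_cast i4
      have r1 : s' = 0 := by
        rw [← norm_eq_zero]; nlinarith [sq_nonneg ‖s'‖, sq_nonneg ‖t'‖]
      have r2 : t' = 0 := by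
        rw [← norm_eq_zero]; nlinarith [sq_nonneg ‖s'‖, sq_nonneg ‖t'‖]
      rw [r1] at d1
      rw [r2] at d2
      have dN : G' w - g ∈ N := ⟨(mem_ker _).2 d1, (mem_ker _).2 d2⟩
      exact sub_eq_zero.1 (inner_self_eq_zero.1 ((Submodule.mem_orthogonal _ _).1 d5 _ dN))
    simp [hG0 n hn, z1, z2, goal']
end

section
/- Suppose the ranges of T, T*, S, and S* are all closed, let □ be the operator with domain dom □ = { u ∈ dom S ∩ dom T* : Su ∈ dom S* and T*u ∈ dom T } defined by □u = S*(Su) + T(T*u), and let G : H₂ → H₂ be the bounded operator with Gv = 0 for v ∈ ℋ and, for u ∈ ℋ^⊥, Gu ∈ dom □ ∩ ℋ^⊥ with □(Gu) = u. Then for every u ∈ dom □ one has G(□u) = u − Hu, where H is the orthogonal projection of H₂ onto ℋ. -/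
/-- If `G` is the complex Green operator (vanishing on `ℋ = ker S ∩ ker T*` and inverting
the complex Laplacian `□u = S*(Su) + T(T*u)` on `ℋᗮ`), then `G(□u) = u - Hu` for every
`u ∈ dom □`, where `H` is the orthogonal projection onto `ℋ`. -/
theorem green_box_eq_id_sub_harmonic_projection
    {H₁ H₂ H₃ : Type*}
    [NormedAddCommGroup H₁] [InnerProductSpace ℂ H₁] [CompleteSpace H₁]
    [NormedAddCommGroup H₂] [InnerProductSpace ℂ H₂] [CompleteSpace H₂]
    [NormedAddCommGroup H₃] [InnerProductSpace ℂ H₃] [CompleteSpace H₃]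
    (T : H₁ →ₗ.[ℂ] H₂) (S : H₂ →ₗ.[ℂ] H₃)
    (hTdense : Dense (T.domain : Set H₁)) (hSdense : Dense (S.domain : Set H₂))
    (hTclosed : T.IsClosed) (hSclosed : S.IsClosed)
    (hTS : T.rangeSubmodule ≤ S.kerSubmodule)
    (hTrange : IsClosed (T.rangeSubmodule : Set H₂))
    (hTadjrange : IsClosed (T.adjoint.rangeSubmodule : Set H₁))
    (hSrange : IsClosed (S.rangeSubmodule : Set H₃))
    (hSadjrange : IsClosed (S.adjoint.rangeSubmodule : Set H₂))
    -- `G` is the complex Green operator: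
    (G : H₂ →L[ℂ] H₂)
    (hG0 : ∀ v ∈ S.kerSubmodule ⊓ T.adjoint.kerSubmodule, G v = 0)
    (hGinv : ∀ u ∈ (S.kerSubmodule ⊓ T.adjoint.kerSubmodule)ᗮ,
      ∃ (h1 : G u ∈ S.domain) (h2 : G u ∈ T.adjoint.domain)
        (h3 : S ⟨G u, h1⟩ ∈ S.adjoint.domain) (h4 : T.adjoint ⟨G u, h2⟩ ∈ T.domain),
        G u ∈ (S.kerSubmodule ⊓ T.adjoint.kerSubmodule)ᗮ ∧
        S.adjoint ⟨S ⟨G u, h1⟩, h3⟩ + T ⟨T.adjoint ⟨G u, h2⟩, h4⟩ = u)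
    -- `Hproj` is the orthogonal projection of `H₂` onto `ℋ = ker S ∩ ker T*`:
    (Hproj : H₂ → H₂)
    (hHmem : ∀ u, Hproj u ∈ S.kerSubmodule ⊓ T.adjoint.kerSubmodule)
    (hHorth : ∀ u, u - Hproj u ∈ (S.kerSubmodule ⊓ T.adjoint.kerSubmodule)ᗮ) :
    ∀ u (huS : u ∈ S.domain) (huT : u ∈ T.adjoint.domain)
      (hS : S ⟨u, huS⟩ ∈ S.adjoint.domain) (hT : T.adjoint ⟨u, huT⟩ ∈ T.domain),
      G (S.adjoint ⟨S ⟨u, huS⟩, hS⟩ + T ⟨T.adjoint ⟨u, huT⟩, hT⟩) = u - Hproj u := by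
  intro u huS huT hS hT
  have fS := LinearPMap.adjoint_isFormalAdjoint hSdense
  have fT := LinearPMap.adjoint_isFormalAdjoint hTdense
  have hmem : ∀ v, v ∈ S.kerSubmodule ⊓ T.adjoint.kerSubmodule ↔
      (∃ h : v ∈ S.domain, S ⟨v, h⟩ = 0) ∧ (∃ h : v ∈ T.adjoint.domain, T.adjoint ⟨v, h⟩ = 0) := by
    intro v
    constructor
    · rintro ⟨⟨a, ha, rfl⟩, ⟨b, hb, hab⟩⟩
      refine ⟨⟨a.2, ha⟩, ⟨?_, ?_⟩⟩
      · rw [← hab]; exact b.2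
      · have : b = ⟨S.domain.subtype a, by rw [← hab]; exact b.2⟩ := Subtype.ext hab
        rw [← this]; exact hb
    · rintro ⟨⟨h, e⟩, ⟨h', e'⟩⟩
      exact ⟨⟨⟨v, h⟩, e, rfl⟩, ⟨⟨v, h'⟩, e', rfl⟩⟩
  have hf : S.adjoint ⟨S ⟨u, huS⟩, hS⟩ + T ⟨T.adjoint ⟨u, huT⟩, hT⟩ ∈
      (S.kerSubmodule ⊓ T.adjoint.kerSubmodule)ᗮ := by
    rw [Submodule.mem_orthogonal']
    intro v hv
    obtain ⟨⟨h, e⟩, ⟨h', e'⟩⟩ := (hmem v).1 hv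
    have e1 := fS ⟨S ⟨u, huS⟩, hS⟩ ⟨v, h⟩
    have e2 := fT ⟨v, h'⟩ ⟨T.adjoint ⟨u, huT⟩, hT⟩
    rw [e, inner_zero_right] at e1
    rw [e', inner_zero_left] at e2
    rw [inner_add_left]
    have e3 : inner ℂ (T ⟨T.adjoint ⟨u, huT⟩, hT⟩) v = 0 := inner_eq_zero_symm.1 e2.symm
    rw [e3, add_zero]
    exact e1
  obtain ⟨h1, h2, h3, h4, horth, heq⟩ := hGinv _ hf
  generalize G (S.adjoint ⟨S ⟨u, huS⟩, hS⟩ + T ⟨T.adjoint ⟨u, huT⟩, hT⟩) = w at *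
  have dS : S (⟨u, huS⟩ - ⟨w, h1⟩) = S ⟨u, huS⟩ - S ⟨w, h1⟩ := LinearPMap.map_sub _ _ _
  have dT : T.adjoint (⟨u, huT⟩ - ⟨w, h2⟩) = T.adjoint ⟨u, huT⟩ - T.adjoint ⟨w, h2⟩ :=
    LinearPMap.map_sub _ _ _
  have dSS := LinearPMap.map_sub S.adjoint ⟨S ⟨u, huS⟩, hS⟩ ⟨S ⟨w, h1⟩, h3⟩
  have dTT := LinearPMap.map_sub T ⟨T.adjoint ⟨u, huT⟩, hT⟩ ⟨T.adjoint ⟨w, h2⟩, h4⟩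
  have e1 := fS (⟨S ⟨u, huS⟩, hS⟩ - ⟨S ⟨w, h1⟩, h3⟩) (⟨u, huS⟩ - ⟨w, h1⟩)
  have e2 := fT (⟨u, huT⟩ - ⟨w, h2⟩) (⟨T.adjoint ⟨u, huT⟩, hT⟩ - ⟨T.adjoint ⟨w, h2⟩, h4⟩)
  rw [dS, dSS] at e1
  rw [dT, dTT] at e2
  simp only [AddSubgroupClass.coe_sub] at e1 e2
  have hz : (S.adjoint ⟨S ⟨u, huS⟩, hS⟩ - S.adjoint ⟨S ⟨w, h1⟩, h3⟩) =
      - (T ⟨T.adjoint ⟨u, huT⟩, hT⟩ - T ⟨T.adjoint ⟨w, h2⟩, h4⟩) := by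
    rw [← sub_eq_zero]
    rw [← sub_eq_zero] at heq
    rw [← neg_eq_zero, ← heq]
    abel
  rw [hz, inner_neg_left, ← inner_conj_symm, ← e2, inner_conj_symm] at e1
  have e3 := congrArg Complex.re e1
  have p1 := inner_self_eq_norm_sq (𝕜 := ℂ) (S ⟨u, huS⟩ - S ⟨w, h1⟩)
  have p2 := inner_self_eq_norm_sq (𝕜 := ℂ) (T.adjoint ⟨u, huT⟩ - T.adjoint ⟨w, h2⟩)
  simp only [RCLike.re_to_complex] at p1 p2
  rw [Complex.neg_re, p1, p2] at e3
  have q1 : S ⟨u, huS⟩ - S ⟨w, h1⟩ = 0 := by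
    rw [← norm_eq_zero, ← sq_eq_zero_iff]
    nlinarith [sq_nonneg ‖S ⟨u, huS⟩ - S ⟨w, h1⟩‖,
      sq_nonneg ‖T.adjoint ⟨u, huT⟩ - T.adjoint ⟨w, h2⟩‖]
  have q2 : T.adjoint ⟨u, huT⟩ - T.adjoint ⟨w, h2⟩ = 0 := by
    rw [← norm_eq_zero, ← sq_eq_zero_iff]
    nlinarith [sq_nonneg ‖S ⟨u, huS⟩ - S ⟨w, h1⟩‖,
      sq_nonneg ‖T.adjoint ⟨u, huT⟩ - T.adjoint ⟨w, h2⟩‖]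
  have hd : u - w ∈ S.kerSubmodule ⊓ T.adjoint.kerSubmodule :=
    (hmem _).2 ⟨⟨S.domain.sub_mem huS h1, dS.trans q1⟩,
      ⟨T.adjoint.domain.sub_mem huT h2, dT.trans q2⟩⟩
  have m1 := Submodule.sub_mem _ hd (hHmem u)
  have m2 := Submodule.sub_mem _ (hHorth u) horth
  have m3 : u - Hproj u - w = u - w - Hproj u := by abel
  rw [m3] at m2
  have m4 := inner_self_eq_zero.1 ((Submodule.mem_orthogonal _ _).1 m2 _ m1)
  rw [← m3, sub_eq_zero] at m4
  exact m4.symm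
end

section
/- Suppose the ranges of T, T*, S, and S* are all closed. Let R_T : H₂ → H₁ be the bounded operator that vanishes on (range T)^⊥ and satisfies, for u ∈ range T: R_T u ∈ dom T, R_T u ⊥ ker T, and T(R_T u) = u; let Q_T : H₁ → H₂ be the bounded operator that vanishes on (range T*)^⊥ and satisfies, for v ∈ range T*: Q_T v ∈ dom T*, Q_T v ⊥ ker T*, and T*(Q_T v) = v; let R_S : H₃ → H₂ be the analogous canonical solution operator for S and Q_{S*} : H₂ → H₃ the analogous canonical solution operator for S*. Let S' and S'' be the orthogonal projections of H₂ onto range T and range S*, and let G be the bounded operator with Gv = 0 for v ∈ ℋ and, for u ∈ ℋ^⊥, Gu ∈ dom □ ∩ ℋ^⊥ with □(Gu) = u, where □u = S*(Su) + T(T*u) on dom □ = { u ∈ dom S ∩ dom T* : Su ∈ dom S*, T*u ∈ dom T }. Then G = Q_T ∘ R_T ∘ S' + R_S ∘ Q_{S*} ∘ S''. -/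
section Helpers

variable {E F : Type*} [NormedAddCommGroup E] [InnerProductSpace ℂ E]
  [NormedAddCommGroup F] [InnerProductSpace ℂ F]

lemma mem_kerSub (A : E →ₗ.[ℂ] F) (x : E) :
    x ∈ A.kerSubmodule ↔ ∃ h : x ∈ A.domain, A ⟨x, h⟩ = 0 := by
  constructor
  · rintro ⟨y, hy, rfl⟩
    exact ⟨y.2, hy⟩
  · rintro ⟨h, hx⟩
    exact ⟨⟨x, h⟩, hx, rfl⟩

lemma apply_mem_rangeSub (A : E →ₗ.[ℂ] F) (x : A.domain) : A x ∈ A.rangeSubmodule :=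
  ⟨x, rfl⟩

lemma isClosed_kerSub (A : E →ₗ.[ℂ] F) (hA : A.IsClosed) :
    IsClosed (A.kerSubmodule : Set E) := by
  have h : (A.kerSubmodule : Set E) = (fun x : E => (x, (0 : F))) ⁻¹' (A.graph : Set (E × F)) := by
    ext x
    simp only [SetLike.mem_coe, mem_kerSub, Set.mem_preimage, LinearPMap.mem_graph_iff]
    constructor
    · rintro ⟨h, hx⟩
      exact ⟨⟨x, h⟩, rfl, hx⟩
    · rintro ⟨y, hy, hx⟩
      subst hy
      exact ⟨y.2, hx⟩
  rw [h]
  exact IsClosed.preimage (by fun_prop) hA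

variable [CompleteSpace E]

lemma adj_inner (A : E →ₗ.[ℂ] F) (hA : Dense (A.domain : Set E)) (y : A.adjoint.domain)
    (x : A.domain) : inner ℂ (A.adjoint y) (x : E) = inner ℂ (y : F) (A x) :=
  A.adjoint_isFormalAdjoint hA y x

lemma range_orth (A : E →ₗ.[ℂ] F) (hA : Dense (A.domain : Set E)) :
    (A.rangeSubmodule)ᗮ = A.adjoint.kerSubmodule := by
  ext y
  rw [mem_kerSub, Submodule.mem_orthogonal']
  constructor
  · intro h
    have h0 : ∀ x : A.domain, inner ℂ (0 : E) (x : E) = inner ℂ y (A x) := fun x => by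
      rw [h _ (apply_mem_rangeSub A x), inner_zero_left]
    have hd := A.mem_adjoint_domain_of_exists y ⟨0, h0⟩
    exact ⟨hd, LinearPMap.adjoint_apply_eq hA ⟨y, hd⟩ h0⟩
  · rintro ⟨hd, h0⟩ _ ⟨x, rfl⟩
    have := adj_inner A hA ⟨y, hd⟩ x
    rw [h0, inner_zero_left] at this
    exact this.symm

lemma adj_range_perp (A : E →ₗ.[ℂ] F) (hA : Dense (A.domain : Set E)) :
    A.adjoint.rangeSubmodule ≤ (A.kerSubmodule)ᗮ := by
  rintro _ ⟨y, rfl⟩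
  rw [Submodule.mem_orthogonal']
  intro x hx
  obtain ⟨hd, h0⟩ := (mem_kerSub A x).1 hx
  have := adj_inner A hA y ⟨x, hd⟩
  rw [h0, inner_zero_right] at this
  exact this

/-- Solutions of `A x = A y` orthogonal to the kernel are unique. -/
lemma sol_unique (A : E →ₗ.[ℂ] F) {x y : E} (hx : x ∈ A.domain) (hy : y ∈ A.domain)
    (hxy : A ⟨x, hx⟩ = A ⟨y, hy⟩) : x - y ∈ A.kerSubmodule := by
  rw [mem_kerSub]
  refine ⟨A.domain.sub_mem hx hy, ?_⟩
  have := A.map_sub ⟨x, hx⟩ ⟨y, hy⟩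
  rw [hxy, sub_self] at this
  exact this

end Helpers

lemma eq_of_perp {E : Type*} [NormedAddCommGroup E] [InnerProductSpace ℂ E]
    (K : Submodule ℂ E) {x y : E} (h : x - y ∈ K) (h' : x - y ∈ Kᗮ) : x = y := by
  rw [← sub_eq_zero, ← inner_self_eq_zero (𝕜 := ℂ)]
  exact (Submodule.mem_orthogonal K _).1 h' _ h

/-- The complex Green operator factors through the canonical solution operators and the
Szegő projections: `G = Q_T ∘ R_T ∘ S' + R_S ∘ Q_{S*} ∘ S''`. -/
theorem green_operator_formula
    {H₁ H₂ H₃ : Type*}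
    [NormedAddCommGroup H₁] [InnerProductSpace ℂ H₁] [CompleteSpace H₁]
    [NormedAddCommGroup H₂] [InnerProductSpace ℂ H₂] [CompleteSpace H₂]
    [NormedAddCommGroup H₃] [InnerProductSpace ℂ H₃] [CompleteSpace H₃]
    (T : H₁ →ₗ.[ℂ] H₂) (S : H₂ →ₗ.[ℂ] H₃)
    (hTdense : Dense (T.domain : Set H₁)) (hSdense : Dense (S.domain : Set H₂))
    (hTclosed : T.IsClosed) (hSclosed : S.IsClosed)
    (hTS : T.rangeSubmodule ≤ S.kerSubmodule)
    (hTrange : IsClosed (T.rangeSubmodule : Set H₂))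
    (hTadjrange : IsClosed (T.adjoint.rangeSubmodule : Set H₁))
    (hSrange : IsClosed (S.rangeSubmodule : Set H₃))
    (hSadjrange : IsClosed (S.adjoint.rangeSubmodule : Set H₂))
    -- `RT` is the canonical solution operator of `T`:
    (RT : H₂ →L[ℂ] H₁)
    (hRT0 : ∀ u ∈ (T.rangeSubmodule)ᗮ, RT u = 0)
    (hRT : ∀ u ∈ T.rangeSubmodule, ∃ h : RT u ∈ T.domain,
      RT u ∈ (T.kerSubmodule)ᗮ ∧ T ⟨RT u, h⟩ = u)
    -- `QT` is the canonical solution operator of `T*`: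
    (QT : H₁ →L[ℂ] H₂)
    (hQT0 : ∀ v ∈ (T.adjoint.rangeSubmodule)ᗮ, QT v = 0)
    (hQT : ∀ v ∈ T.adjoint.rangeSubmodule, ∃ h : QT v ∈ T.adjoint.domain,
      QT v ∈ (T.adjoint.kerSubmodule)ᗮ ∧ T.adjoint ⟨QT v, h⟩ = v)
    -- `RS` is the canonical solution operator of `S`:
    (RS : H₃ →L[ℂ] H₂)
    (hRS0 : ∀ u ∈ (S.rangeSubmodule)ᗮ, RS u = 0)
    (hRS : ∀ u ∈ S.rangeSubmodule, ∃ h : RS u ∈ S.domain,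
      RS u ∈ (S.kerSubmodule)ᗮ ∧ S ⟨RS u, h⟩ = u)
    -- `QS` is the canonical solution operator of `S*`:
    (QS : H₂ →L[ℂ] H₃)
    (hQS0 : ∀ v ∈ (S.adjoint.rangeSubmodule)ᗮ, QS v = 0)
    (hQS : ∀ v ∈ S.adjoint.rangeSubmodule, ∃ h : QS v ∈ S.adjoint.domain,
      QS v ∈ (S.adjoint.kerSubmodule)ᗮ ∧ S.adjoint ⟨QS v, h⟩ = v)
    -- `S'` is the orthogonal projection of `H₂` onto `range T`:
    (S' : H₂ →L[ℂ] H₂)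
    (hS'mem : ∀ u, S' u ∈ T.rangeSubmodule)
    (hS'orth : ∀ u, u - S' u ∈ (T.rangeSubmodule)ᗮ)
    -- `S''` is the orthogonal projection of `H₂` onto `range S*`:
    (S'' : H₂ →L[ℂ] H₂)
    (hS''mem : ∀ u, S'' u ∈ S.adjoint.rangeSubmodule)
    (hS''orth : ∀ u, u - S'' u ∈ (S.adjoint.rangeSubmodule)ᗮ)
    -- `G` is the complex Green operator:
    (G : H₂ →L[ℂ] H₂)
    (hG0 : ∀ v ∈ S.kerSubmodule ⊓ T.adjoint.kerSubmodule, G v = 0)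
    (hGinv : ∀ u ∈ (S.kerSubmodule ⊓ T.adjoint.kerSubmodule)ᗮ,
      ∃ (h1 : G u ∈ S.domain) (h2 : G u ∈ T.adjoint.domain)
        (h3 : S ⟨G u, h1⟩ ∈ S.adjoint.domain) (h4 : T.adjoint ⟨G u, h2⟩ ∈ T.domain),
        G u ∈ (S.kerSubmodule ⊓ T.adjoint.kerSubmodule)ᗮ ∧
        S.adjoint ⟨S ⟨G u, h1⟩, h3⟩ + T ⟨T.adjoint ⟨G u, h2⟩, h4⟩ = u) :
    ∀ u : H₂, G u = QT (RT (S' u)) + RS (QS (S'' u)) := by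
  have hTo := range_orth T hTdense
  have hSo := range_orth S hSdense
  have hTp := adj_range_perp T hTdense
  have hSp := adj_range_perp S hSdense
  -- uniqueness of the two projections
  have hS'u : ∀ u w, w ∈ T.rangeSubmodule → u - w ∈ (T.rangeSubmodule)ᗮ → S' u = w := by
    intro u w hw hw'
    refine eq_of_perp T.rangeSubmodule (Submodule.sub_mem _ (hS'mem u) hw) ?_
    have := Submodule.sub_mem _ hw' (hS'orth u)
    rwa [sub_sub_sub_cancel_left] at this
  have hS''u : ∀ u w, w ∈ S.adjoint.rangeSubmodule →
      u - w ∈ (S.adjoint.rangeSubmodule)ᗮ → S'' u = w := by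
    intro u w hw hw'
    refine eq_of_perp S.adjoint.rangeSubmodule (Submodule.sub_mem _ (hS''mem u) hw) ?_
    have := Submodule.sub_mem _ hw' (hS''orth u)
    rwa [sub_sub_sub_cancel_left] at this
  have hkerS : S.kerSubmodule ≤ (S.adjoint.rangeSubmodule)ᗮ :=
    (Submodule.le_orthogonal_orthogonal _).trans (Submodule.orthogonal_le hSp)
  have hperp : S.adjoint.rangeSubmodule ≤ (T.rangeSubmodule)ᗮ :=
    hSp.trans (Submodule.orthogonal_le hTS)
  -- the harmonic part
  have hharm : ∀ u ∈ S.kerSubmodule ⊓ T.adjoint.kerSubmodule,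
      G u = QT (RT (S' u)) + RS (QS (S'' u)) := by
    intro u hu
    have h1 : S' u = 0 := hS'u u 0 (Submodule.zero_mem _) (by
      rw [sub_zero, hTo]; exact hu.2)
    have h2 : S'' u = 0 := hS''u u 0 (Submodule.zero_mem _) (by
      rw [sub_zero]; exact hkerS hu.1)
    rw [hG0 u hu, h1, h2]
    simp
  -- the orthogonal part
  have horth : ∀ u ∈ (S.kerSubmodule ⊓ T.adjoint.kerSubmodule)ᗮ,
      G u = QT (RT (S' u)) + RS (QS (S'' u)) := by
    intro u hu
    obtain ⟨h1, h2, h3, h4, hg, he⟩ := hGinv u hu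
    generalize G u = g at *
    have hA : S' u = T ⟨T.adjoint ⟨g, h2⟩, h4⟩ := by
      refine hS'u u _ (apply_mem_rangeSub T _) ?_
      rw [← he, add_sub_cancel_right]
      exact hperp (apply_mem_rangeSub S.adjoint _)
    have hB : S'' u = S.adjoint ⟨S ⟨g, h1⟩, h3⟩ := by
      refine hS''u u _ (apply_mem_rangeSub S.adjoint _) ?_
      rw [← he, add_sub_cancel_left]
      exact hkerS (hTS (apply_mem_rangeSub T _))
    have hC : RT (S' u) = T.adjoint ⟨g, h2⟩ := by
      obtain ⟨hd, hk, hv⟩ := hRT _ (hS'mem u)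
      refine eq_of_perp T.kerSubmodule (sol_unique T hd h4 (hv.trans hA)) ?_
      exact Submodule.sub_mem _ hk (hTp (apply_mem_rangeSub T.adjoint _))
    have hD : QS (S'' u) = S ⟨g, h1⟩ := by
      obtain ⟨hd, hk, hv⟩ := hQS _ (hS''mem u)
      refine eq_of_perp S.adjoint.kerSubmodule (sol_unique S.adjoint hd h3 (hv.trans hB)) ?_
      refine Submodule.sub_mem _ hk ?_
      rw [← hSo]
      exact Submodule.le_orthogonal_orthogonal _ (apply_mem_rangeSub S _)
    rw [hC, hD]
    obtain ⟨had, hak, hav⟩ := hQT _ (apply_mem_rangeSub T.adjoint ⟨g, h2⟩)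
    obtain ⟨hbd, hbk, hbv⟩ := hRS _ (apply_mem_rangeSub S ⟨g, h1⟩)
    have hga := sol_unique T.adjoint h2 had hav.symm
    have hgb := sol_unique S h1 hbd hbv.symm
    generalize QT (T.adjoint ⟨g, h2⟩) = a at *
    generalize RS (S ⟨g, h1⟩) = b at *
    have hbT : b ∈ T.adjoint.kerSubmodule := by
      rw [← hTo]; exact Submodule.orthogonal_le hTS hbk
    have haS : a ∈ S.kerSubmodule := by
      apply hTS
      have : CompleteSpace T.rangeSubmodule := hTrange.completeSpace_coe
      rw [← hTo, Submodule.orthogonal_orthogonal] at hak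
      exact hak
    refine eq_of_perp (S.kerSubmodule ⊓ T.adjoint.kerSubmodule) ⟨?_, ?_⟩ ?_
    · have := Submodule.sub_mem _ hgb haS
      rwa [sub_sub, add_comm b a] at this
    · have := Submodule.sub_mem _ hga hbT
      rwa [sub_sub] at this
    · exact Submodule.sub_mem _ hg (Submodule.add_mem _
        (Submodule.orthogonal_le inf_le_right hak) (Submodule.orthogonal_le inf_le_left hbk))
  intro u
  have hcl : IsClosed ((S.kerSubmodule ⊓ T.adjoint.kerSubmodule : Submodule ℂ H₂) : Set H₂) := by
    rw [Submodule.coe_inf]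
    refine (isClosed_kerSub S hSclosed).inter ?_
    rw [← hTo]
    exact Submodule.isClosed_orthogonal _
  have : CompleteSpace (S.kerSubmodule ⊓ T.adjoint.kerSubmodule : Submodule ℂ H₂) :=
    hcl.completeSpace_coe
  obtain ⟨v, hv, w, hw, rfl⟩ :=
    (S.kerSubmodule ⊓ T.adjoint.kerSubmodule).exists_add_mem_mem_orthogonal u
  simp only [map_add]
  rw [hharm v hv, horth w hw]
  abel
end
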